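/- Assume there exists u′ ∈ M with ⟨p, u′⟩ = 0 and ⟨p_j, u′⟩ > 0 for all j ≥ 2 (such u′ exists when p₁, …, p_m span distinct rays of a strongly convex cone). Then a monoid homomorphism x : (S, +) → (K, ·) is invertible for the product * (i.e. there exists a monoid homomorphism y with x*y = y*x = x_ρ, where x_ρ(u) = 1 if ⟨p, u⟩ = 0 and x_ρ(u) = 0 otherwise) if and only if x(u) ≠ 0 for every u ∈ S with ⟨p, u⟩ = 0. -/

import Mathlib

open Finset

/-- The monoid `S = σ∨ ∩ M` of lattice points of the dual cone: elements `u ∈ M` with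
`⟨p_j, u⟩ ≥ 0` for all `j`. -/
def dualS {M : Type*} [AddCommGroup M] {m : ℕ} (p : Fin (m + 1) → (M →+ ℤ)) :
    AddSubmonoid M where
  carrier := {u | ∀ j, 0 ≤ p j u}
  zero_mem' := fun j => by simp
  add_mem' := fun {u v} hu hv j => by
    rw [map_add]; exact add_nonneg (hu j) (hv j)

/-- A point of the affine toric variety `X_σ`: a monoid homomorphism `(S, +) → (K, ·)`. -/
def IsPoint {K M : Type*} [Field K] [AddCommGroup M] {m : ℕ}
    (p : Fin (m + 1) → (M →+ ℤ)) (x : dualS p → K) : Prop :=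
  x 0 = 1 ∧ ∀ u v : dualS p, x (u + v) = x u * x v

open Classical in
/-- Extension of a function on `S` to all of `M` by zero. -/
noncomputable def extend {K M : Type*} [Field K] [AddCommGroup M] {m : ℕ}
    (p : Fin (m + 1) → (M →+ ℤ)) (x : dualS p → K) : M → K :=
  fun v => if h : v ∈ dualS p then x ⟨v, h⟩ else 0

/-- `e` is a Demazure root corresponding to the distinguished ray spanned by `p 0`:
`⟨p 0, e⟩ = −1` and `⟨p j, e⟩ ≥ 0` for all other `j`. -/
def IsDemazureRoot {M : Type*} [AddCommGroup M] {m : ℕ}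
    (p : Fin (m + 1) → (M →+ ℤ)) (e : M) : Prop :=
  p 0 e = -1 ∧ ∀ j, j ≠ 0 → 0 ≤ p j e

/-- The product of two points:
`(x*y)(u) = Σ_{i+j=⟨p,u⟩} C(⟨p,u⟩,i) · x(u + i·e₂) · y(u + j·e₁)`. -/
noncomputable def prodPt {K M : Type*} [Field K] [AddCommGroup M] {m : ℕ}
    (p : Fin (m + 1) → (M →+ ℤ)) (e₁ e₂ : M) (x y : dualS p → K) : dualS p → K :=
  fun u => ∑ i ∈ Finset.range ((p 0 (u : M)).toNat + 1),
    ((p 0 (u : M)).toNat.choose i : K) *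
      extend p x ((u : M) + i • e₂) *
      extend p y ((u : M) + ((p 0 (u : M)).toNat - i) • e₁)

/-- The identity element `x_ρ` : `x_ρ(u) = 1` if `⟨p, u⟩ = 0` and `0` otherwise. -/
noncomputable def xrho {K M : Type*} [Field K] [AddCommGroup M] {m : ℕ}
    (p : Fin (m + 1) → (M →+ ℤ)) : dualS p → K :=
  fun u => if p 0 (u : M) = 0 then 1 else 0

section

variable {K M : Type*} [Field K] [AddCommGroup M] {m : ℕ} {p : Fin (m + 1) → (M →+ ℤ)}

theorem extend_of_mem (x : dualS p → K) {v : M} (h : v ∈ dualS p) :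
    extend p x v = x ⟨v, h⟩ := dif_pos h

theorem extend_coe (x : dualS p → K) (v : dualS p) : extend p x (v : M) = x v :=
  extend_of_mem x v.2

theorem IsPoint.extend_add {x : dualS p → K} (hx : IsPoint p x) {u v : M}
    (hu : u ∈ dualS p) (hv : v ∈ dualS p) :
    extend p x (u + v) = extend p x u * extend p x v := by
  rw [extend_of_mem x hu, extend_of_mem x hv, extend_of_mem x (add_mem hu hv), ← hx.2]
  rfl

theorem IsDemazureRoot.apply_add_nsmul {e : M} (he : IsDemazureRoot p e) (u : M) (k : ℕ) :
    p 0 (u + k • e) = p 0 u - k := by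
  rw [map_add, map_nsmul, he.1]
  simp
  ring

theorem IsDemazureRoot.add_nsmul_mem {e : M} (he : IsDemazureRoot p e) {u : M}
    (hu : u ∈ dualS p) {k : ℕ} (hk : (k : ℤ) ≤ p 0 u) : u + k • e ∈ dualS p := by
  intro j
  by_cases hj : j = 0
  · subst hj
    rw [he.apply_add_nsmul]
    linarith
  · rw [map_add, map_nsmul]
    exact add_nonneg (hu j) (nsmul_nonneg (he.2 j hj) k)

theorem toNat_apply_coe (u : dualS p) : (((p 0 (u : M)).toNat : ℕ) : ℤ) = p 0 (u : M) :=
  Int.toNat_of_nonneg (u.2 0)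

/-- The candidate inverse of a point `x` for the product `*`. -/
noncomputable def invPt (p : Fin (m + 1) → (M →+ ℤ)) (e₁ e₂ : M) (x : dualS p → K) :
    dualS p → K :=
  fun u => (-1) ^ (p 0 (u : M)).toNat * x u /
    (extend p x ((u : M) + (p 0 (u : M)).toNat • e₁) *
      extend p x ((u : M) + (p 0 (u : M)).toNat • e₂))

theorem invPt_comm (e₁ e₂ : M) (x : dualS p → K) : invPt p e₁ e₂ x = invPt p e₂ e₁ x := by
  funext u
  unfold invPt
  rw [mul_comm (extend p x _)]

theorem IsPoint.extend_add_add_nsmul {x : dualS p → K} (hx : IsPoint p x) {e : M}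
    (he : IsDemazureRoot p e) (u v : dualS p) :
    extend p x (((u + v : dualS p) : M) + (p 0 ((u + v : dualS p) : M)).toNat • e) =
      extend p x ((u : M) + (p 0 (u : M)).toNat • e) *
        extend p x ((v : M) + (p 0 (v : M)).toNat • e) := by
  rw [← hx.extend_add (he.add_nsmul_mem u.2 (toNat_apply_coe u).le)
    (he.add_nsmul_mem v.2 (toNat_apply_coe v).le), AddSubmonoid.coe_add, map_add,
    Int.toNat_add (u.2 0) (v.2 0), add_nsmul]
  congr 1
  abel

theorem IsPoint.invPt {x : dualS p → K} (hx : IsPoint p x) {e₁ e₂ : M}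
    (he₁ : IsDemazureRoot p e₁) (he₂ : IsDemazureRoot p e₂) :
    IsPoint p (invPt p e₁ e₂ x) := by
  constructor
  · have h0 : extend p x (0 : M) = 1 := by
      rw [← hx.1, ← extend_coe x 0, AddSubmonoid.coe_zero]
    simp [_root_.invPt, h0, hx.1]
  · intro u v
    simp only [_root_.invPt]
    rw [hx.extend_add_add_nsmul he₁, hx.extend_add_add_nsmul he₂, hx.2, AddSubmonoid.coe_add,
      map_add, Int.toNat_add (u.2 0) (v.2 0), pow_add, div_mul_div_comm]
    congr 1 <;> ring

/-- Exchanging the factors of the product amounts to exchanging the two roots. -/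
theorem prodPt_swap (e₁ e₂ : M) (x y : dualS p → K) :
    prodPt p e₁ e₂ y x = prodPt p e₂ e₁ x y := by
  funext u
  simp only [prodPt]
  rw [← Finset.sum_range_reflect]
  refine Finset.sum_congr rfl fun i hi => ?_
  have hi' : i ≤ (p 0 (u : M)).toNat := Nat.lt_succ_iff.mp (Finset.mem_range.mp hi)
  rw [show (p 0 (u : M)).toNat + 1 - 1 - i = (p 0 (u : M)).toNat - i by omega,
    Nat.choose_symm hi', Nat.sub_sub_self hi']
  ring

theorem IsPoint.prodPt_invPt {x : dualS p → K} (hx : IsPoint p x) {e₁ e₂ : M}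
    (he₁ : IsDemazureRoot p e₁) (he₂ : IsDemazureRoot p e₂)
    (hne : ∀ u : dualS p, p 0 (u : M) = 0 → x u ≠ 0) :
    prodPt p e₁ e₂ x (_root_.invPt p e₁ e₂ x) = xrho p := by
  have hne' : ∀ v : M, v ∈ dualS p → p 0 v = 0 → extend p x v ≠ 0 := fun v hv h0 => by
    rw [extend_of_mem x hv]
    exact hne ⟨v, hv⟩ h0
  funext u
  have hn := toNat_apply_coe u
  simp only [prodPt, xrho]
  generalize (p 0 (u : M)).toNat = n at hn ⊢
  have hterm : ∀ i ∈ Finset.range (n + 1),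
      (n.choose i : K) * extend p x ((u : M) + i • e₂) *
        extend p (_root_.invPt p e₁ e₂ x) ((u : M) + (n - i) • e₁) =
      (x u / extend p x ((u : M) + n • e₁)) * ((-1) ^ i * 1 ^ (n - i) * (n.choose i : K)) := by
    intro i hi
    obtain ⟨j, rfl⟩ := Nat.exists_eq_add_of_le (Nat.lt_succ_iff.mp (Finset.mem_range.mp hi))
    push_cast at hn
    rw [Nat.add_sub_cancel_left]
    have h₁ : (u : M) + j • e₁ ∈ dualS p := he₁.add_nsmul_mem u.2 (by omega)
    have h₂ : (u : M) + i • e₂ ∈ dualS p := he₂.add_nsmul_mem u.2 (by omega)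
    have hp₁ : p 0 ((u : M) + j • e₁) = i := by rw [he₁.apply_add_nsmul]; omega
    have h₁₂ : (u : M) + j • e₁ + i • e₂ ∈ dualS p := he₂.add_nsmul_mem h₁ hp₁.ge
    have hA : extend p x ((u : M) + j • e₁ + i • e₂) ≠ 0 :=
      hne' _ h₁₂ (by rw [he₂.apply_add_nsmul, hp₁, sub_self])
    have hB : extend p x ((u : M) + (i + j) • e₁) ≠ 0 :=
      hne' _ (he₁.add_nsmul_mem u.2 (by push_cast; omega))
        (by rw [he₁.apply_add_nsmul]; push_cast; omega)
    have hmul : extend p x ((u : M) + i • e₂) * extend p x ((u : M) + j • e₁) =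
        x u * extend p x ((u : M) + j • e₁ + i • e₂) := by
      rw [← extend_coe x u, ← hx.extend_add h₂ h₁, ← hx.extend_add u.2 h₁₂]
      congr 1
      abel
    rw [extend_of_mem _ h₁]
    simp only [_root_.invPt, hp₁, Int.toNat_natCast]
    rw [← extend_of_mem x h₁,
      show (u : M) + j • e₁ + i • e₁ = (u : M) + (i + j) • e₁ by rw [add_nsmul]; abel]
    field_simp
    linear_combination ((i + j).choose i : K) * hmul
  rw [Finset.sum_congr rfl hterm, ← Finset.mul_sum, ← add_pow, neg_add_cancel, ← hn]
  rcases Nat.eq_zero_or_pos n with rfl | hpos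
  · have := hne u (by simpa using hn.symm)
    simp [extend_coe, this]
  · simp [hpos.ne']

end

/-- Assume there is `u' ∈ M` with `⟨p, u'⟩ = 0` and `⟨p_j, u'⟩ > 0` for all
`j ≠ 0`.  Then a monoid homomorphism `x : (S, +) → (K, ·)` is invertible for `*` iff
`x(u) ≠ 0` for every `u ∈ S` with `⟨p, u⟩ = 0`. -/
theorem stmt_6 {K M : Type*} [Field K] [IsAlgClosed K] [CharZero K]
    [AddCommGroup M] [Module.Free ℤ M] [Module.Finite ℤ M] {m : ℕ}
    (p : Fin (m + 1) → (M →+ ℤ)) (e₁ e₂ : M)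
    (he₁ : IsDemazureRoot p e₁) (he₂ : IsDemazureRoot p e₂)
    (hu' : ∃ u' : M, p 0 u' = 0 ∧ ∀ j, j ≠ 0 → 0 < p j u')
    (x : dualS p → K) (hx : IsPoint p x) :
    (∃ y : dualS p → K, IsPoint p y ∧
        prodPt p e₁ e₂ x y = xrho p ∧ prodPt p e₁ e₂ y x = xrho p) ↔
      ∀ u : dualS p, p 0 (u : M) = 0 → x u ≠ 0 := by
  constructor
  · rintro ⟨y, -, hxy, -⟩ u hu h0
    have h := congrFun hxy u
    simp [prodPt, xrho, hu, extend_coe, h0] at h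
  · intro hne
    refine ⟨invPt p e₁ e₂ x, hx.invPt he₁ he₂, hx.prodPt_invPt he₁ he₂ hne, ?_⟩
    rw [prodPt_swap, invPt_comm]
    exact hx.prodPt_invPt he₂ he₁ hne
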